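/- Let m = 2^ℓ·n ≥ 3 with n odd, ℓ ≥ 0, n ≥ 1, and let D_m be the dihedral group of order 2m. Then Λ(D_m), viewed as a set of maps D_m → D_m, equals the disjoint union C(0,1) ∪ ⋃_{i=1}^{t'} C(2^i, 2^{i−1}), where t' = ord_m(2) if ℓ = 0 and n > 1; t' = ℓ + per_m(2) − 1 if ℓ > 0 and n > 1; and t' = ℓ − 1 if ℓ > 0 and n = 1. All containers appearing in the union are pairwise disjoint. -/

import Mathlib

open DihedralGroup

/-- The commutator `[g,h] = g⁻¹ h⁻¹ g h`. -/
def gcomm {G : Type*} [Group G] (g h : G) : G := g⁻¹ * h⁻¹ * g * h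

/-- The right commutation map `ρ(g) : x ↦ [x,g]`. -/
def rmap {G : Type*} [Group G] (g : G) : G → G := fun x => gcomm x g

/-- The left commutation map `λ(g) : x ↦ [g,x]`. -/
def lmap {G : Type*} [Group G] (g : G) : G → G := fun x => gcomm g x

/-- The element `a^i b^j` of the dihedral group `D_m`, where `a = r 1`, `b = sr 0`. -/
def elt (m : ℕ) (i : ZMod m) (j : ZMod 2) : DihedralGroup m :=
  r i * (sr 0 : DihedralGroup m) ^ j.val

/-- The map `μ(A,B)`, sending `a^i b^j` to `a^(A·i·(-1)^j − B·((-1)^j − 1))`.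
Note `sr k = a^(-k) b`, so `μ(A,B)` sends `sr k` to `r (A·k + 2·B)`. -/
def mumap (m : ℕ) (A B : ZMod m) : DihedralGroup m → DihedralGroup m
  | .r i => .r (A * i)
  | .sr k => .r (A * k + 2 * B)

/-- The `(A,B)`-container `C(A,B) = { μ(A, x·B) : x ∈ ℤ_m }`. -/
def cont (m : ℕ) (A B : ZMod m) : Set (DihedralGroup m → DihedralGroup m) :=
  { f | ∃ x : ZMod m, f = mumap m A (x * B) }

/-- The left commutation semigroup `Λ(D_m)`: the subsemigroup of the semigroup of all
maps `D_m → D_m` under composition generated by the λ-maps. -/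
def Lsg (m : ℕ) : Subsemigroup (Function.End (DihedralGroup m)) :=
  Subsemigroup.closure {f : Function.End (DihedralGroup m) | ∃ g : DihedralGroup m, f = lmap g}

/-- The index of `x` in the multiplicative semigroup `ℤ_m`. -/
noncomputable def ind (m : ℕ) (x : ZMod m) : ℕ :=
  sInf {c : ℕ | 0 < c ∧ ∃ k : ℕ, 0 < k ∧ x ^ c = x ^ (c + k)}

/-- The period of `x` in the multiplicative semigroup `ℤ_m`. -/
noncomputable def per (m : ℕ) (x : ZMod m) : ℕ :=
  sInf {k : ℕ | 0 < k ∧ x ^ ind m x = x ^ (ind m x + k)}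

theorem lmap_r (m : ℕ) (c : ZMod m) : lmap (DihedralGroup.r c) = mumap m 0 (-c) := by
  funext x
  rcases x with i | k
  · simp [lmap, gcomm, mumap]
  · simp only [lmap, gcomm, mumap, inv_r, inv_sr, r_mul_sr, sr_mul_r, sr_mul_sr]
    congr 1
    ring

theorem lmap_sr (m : ℕ) (c : ZMod m) : lmap (DihedralGroup.sr c) = mumap m 2 (-c) := by
  funext x
  rcases x with i | k
  · simp only [lmap, gcomm, mumap, inv_r, inv_sr, sr_mul_r, sr_mul_sr, r_mul_r]
    congr 1
    ring
  · simp only [lmap, gcomm, mumap, inv_sr, r_mul_sr, sr_mul_sr]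
    congr 1
    ring

theorem mumap_comp (m : ℕ) (A B A' B' : ZMod m) :
    mumap m A B ∘ mumap m A' B' = mumap m (A * A') (A * B') := by
  funext x
  rcases x with i | k
  · simp [mumap, mul_assoc]
  · simp only [mumap, Function.comp]
    congr 1
    ring

theorem mumap_congr {m : ℕ} {A B A' B' : ZMod m} (hA : A = A') (hB : 2 * B = 2 * B') :
    mumap m A B = mumap m A' B' := by
  subst hA
  funext x
  rcases x with i | k
  · rfl
  · simp [mumap, hB]

theorem cont_congr {m : ℕ} {A B A' B' : ZMod m} (hA : A = A') (hB : 2 * B = 2 * B') :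
    cont m A B = cont m A' B' := by
  ext f
  have h (x : ZMod m) : mumap m A (x * B) = mumap m A' (x * B') :=
    mumap_congr hA (by linear_combination x * hB)
  simp [cont, h]

theorem disjoint_cont {m : ℕ} {A A' : ZMod m} (B B' : ZMod m) (h : A ≠ A') :
    Disjoint (cont m A B) (cont m A' B') := by
  rw [Set.disjoint_left]
  rintro f ⟨x, rfl⟩ ⟨y, hy⟩
  have := congrFun hy (DihedralGroup.r 1)
  simp only [mumap, mul_one] at this
  exact h (DihedralGroup.r.inj this)

theorem two_mul_two_pow_pred {R : Type*} [CommSemiring R] {i : ℕ} (hi : 1 ≤ i) :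
    (2 : R) * 2 ^ (i - 1) = 2 ^ i := by
  rw [← pow_succ', Nat.sub_add_cancel hi]

/-- `Λ(D_m)` is the union of `C(0,1)` and of all the containers `C(2^i, 2^(i-1))`. -/
theorem coe_Lsg (m : ℕ) :
    (Lsg m : Set (Function.End (DihedralGroup m))) =
      {f | f ∈ cont m 0 1 ∨ ∃ i, 1 ≤ i ∧ f ∈ cont m ((2 : ZMod m) ^ i) (2 ^ (i - 1))} := by
  have hr (c : ZMod m) : mumap m 0 c ∈ Lsg m :=
    Subsemigroup.subset_closure ⟨DihedralGroup.r (-c), by rw [lmap_r, neg_neg]⟩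
  have hs (c : ZMod m) : mumap m 2 c ∈ Lsg m :=
    Subsemigroup.subset_closure ⟨DihedralGroup.sr (-c), by rw [lmap_sr, neg_neg]⟩
  apply Set.Subset.antisymm
  · intro f hf
    induction hf using Subsemigroup.closure_induction with
    | mem f hf =>
      obtain ⟨g, rfl⟩ := hf
      rcases g with c | c
      · exact Or.inl ⟨-c, by rw [lmap_r, mul_one]⟩
      · exact Or.inr ⟨1, le_rfl, -c, by rw [lmap_sr]; simp⟩
    | mul f g _ _ hf hg =>
      rcases hf with ⟨x, rfl⟩ | ⟨i, hi, x, rfl⟩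
      · have key (A B : ZMod m) : mumap m 0 (x * 1) ∘ mumap m A B ∈ cont m 0 1 :=
          ⟨0, by rw [mumap_comp]; simp⟩
        rcases hg with ⟨y, rfl⟩ | ⟨j, hj, y, rfl⟩ <;> exact Or.inl (key _ _)
      · rcases hg with ⟨y, rfl⟩ | ⟨j, hj, y, rfl⟩
        · exact Or.inl ⟨2 ^ i * y, by
            change mumap m _ _ ∘ mumap m _ _ = _
            rw [mumap_comp]; simp⟩
        · refine Or.inr ⟨i + j, by omega, y, ?_⟩
          change mumap m _ _ ∘ mumap m _ _ = _
          rw [mumap_comp, pow_add, Nat.add_sub_assoc hj, pow_add]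
          congr 1
          ring
  · rintro f (⟨x, rfl⟩ | ⟨i, hi, hf⟩)
    · exact hr _
    · induction i, hi using Nat.le_induction generalizing f with
      | base =>
        obtain ⟨x, rfl⟩ := hf
        rw [pow_one]
        exact hs _
      | succ i hi ih =>
        obtain ⟨x, rfl⟩ := hf
        have h := (Lsg m).mul_mem (hs 0) (ih ⟨x, rfl⟩)
        change mumap m _ _ ∘ mumap m _ _ ∈ _ at h
        rw [mumap_comp] at h
        rwa [← pow_succ', mul_left_comm, two_mul_two_pow_pred hi] at h

/-- Coincidences between powers of `2` modulo `2 ^ ℓ * n` with `n` odd. -/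
theorem two_pow_eq_two_pow_add_iff {ℓ n : ℕ} (hn : Odd n) (i : ℕ) {k : ℕ} (hk : 0 < k) :
    (2 : ZMod (2 ^ ℓ * n)) ^ i = 2 ^ (i + k) ↔ ℓ ≤ i ∧ orderOf (2 : ZMod n) ∣ k := by
  have hk1 : 1 ≤ 2 ^ k := Nat.one_le_two_pow
  have hodd : Odd (2 ^ k - 1) :=
    Nat.Even.sub_odd hk1 ((Nat.even_pow.2 ⟨even_two, hk.ne'⟩)) odd_one
  have h1 : (2 : ZMod (2 ^ ℓ * n)) ^ i = 2 ^ (i + k) ↔ 2 ^ ℓ * n ∣ 2 ^ i * (2 ^ k - 1) := by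
    have := ZMod.natCast_eq_natCast_iff' (2 ^ i) (2 ^ (i + k)) (2 ^ ℓ * n)
    push_cast at this
    rw [this, ← Nat.ModEq, Nat.modEq_iff_dvd' (Nat.pow_le_pow_right two_pos (by omega)), pow_add,
      Nat.mul_sub_one]
  have h2 : orderOf (2 : ZMod n) ∣ k ↔ n ∣ 2 ^ k - 1 := by
    have := ZMod.natCast_eq_natCast_iff' 1 (2 ^ k) n
    push_cast at this
    rw [orderOf_dvd_iff_pow_eq_one, eq_comm, this, ← Nat.ModEq, Nat.modEq_iff_dvd' hk1]
  rw [h1, h2]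
  constructor
  · intro h
    constructor
    · have h3 : 2 ^ ℓ ∣ 2 ^ i :=
        (Nat.Coprime.pow_left ℓ (Nat.coprime_two_left.2 hodd)).dvd_of_dvd_mul_right
          ((Dvd.intro _ rfl).trans h)
      exact (Nat.pow_dvd_pow_iff_le_right one_lt_two).1 h3
    · exact (Nat.Coprime.pow_right i (Nat.coprime_two_right.2 hn)).dvd_of_dvd_mul_left
        ((Dvd.intro_left _ rfl).trans h)
  · rintro ⟨h, h'⟩
    exact mul_dvd_mul (pow_dvd_pow 2 h) h'

theorem two_pow_eq_zero_iff {ℓ n : ℕ} (hn : Odd n) (i : ℕ) :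
    (2 : ZMod (2 ^ ℓ * n)) ^ i = 0 ↔ ℓ ≤ i ∧ n = 1 := by
  have h1 : (2 : ZMod (2 ^ ℓ * n)) ^ i = 0 ↔ 2 ^ ℓ * n ∣ 2 ^ i := by
    rw [← ZMod.natCast_eq_zero_iff]
    push_cast
    rfl
  rw [h1]
  constructor
  · intro h
    exact ⟨(Nat.pow_dvd_pow_iff_le_right one_lt_two).1 ((Dvd.intro _ rfl).trans h),
      (Nat.Coprime.pow_right i (Nat.coprime_two_right.2 hn)).eq_one_of_dvd
        ((Dvd.intro_left _ rfl).trans h)⟩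
  · rintro ⟨h, rfl⟩
    simpa using pow_dvd_pow 2 h

theorem orderOf_two_pos {n : ℕ} (hn : Odd n) : 0 < orderOf (2 : ZMod n) := by
  have : NeZero n := ⟨hn.pos.ne'⟩
  have hu : IsUnit (2 : ZMod n) := by
    simpa using (ZMod.isUnit_iff_coprime 2 n).2 (Nat.coprime_two_left.2 hn)
  obtain ⟨u, hu⟩ := hu
  rw [← hu, orderOf_units]
  exact orderOf_pos u

theorem ind_two {ℓ n : ℕ} (hn : Odd n) (hℓ : 0 < ℓ) : ind (2 ^ ℓ * n) 2 = ℓ := by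
  refine IsLeast.csInf_eq ⟨⟨hℓ, _, orderOf_two_pos hn, ?_⟩, ?_⟩
  · exact (two_pow_eq_two_pow_add_iff hn ℓ (orderOf_two_pos hn)).2 ⟨le_rfl, dvd_rfl⟩
  · rintro c ⟨-, k, hk, h⟩
    exact ((two_pow_eq_two_pow_add_iff hn c hk).1 h).1

theorem per_two {ℓ n : ℕ} (hn : Odd n) (hℓ : 0 < ℓ) :
    per (2 ^ ℓ * n) 2 = orderOf (2 : ZMod n) := by
  unfold per
  rw [ind_two hn hℓ]
  refine IsLeast.csInf_eq ⟨⟨orderOf_two_pos hn, ?_⟩, ?_⟩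
  · exact (two_pow_eq_two_pow_add_iff hn ℓ (orderOf_two_pos hn)).2 ⟨le_rfl, dvd_rfl⟩
  · rintro k ⟨hk, h⟩
    exact Nat.le_of_dvd hk ((two_pow_eq_two_pow_add_iff hn ℓ hk).1 h).2

/-- Theorem 12(ii): `Λ(D_m)` is the disjoint union
`C(0,1) ∪ ⋃_{i=1}^{t'} C(2^i, 2^(i-1))`. -/
theorem stmt_9 (ℓ n m t' : ℕ) (hm : m = 2 ^ ℓ * n) (hm3 : 3 ≤ m) (hn : Odd n)
    (ht' : (ℓ = 0 ∧ 1 < n ∧ t' = orderOf (2 : ZMod m)) ∨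
           (0 < ℓ ∧ 1 < n ∧ t' = ℓ + per m 2 - 1) ∨
           (0 < ℓ ∧ n = 1 ∧ t' = ℓ - 1)) :
    (Lsg m : Set (Function.End (DihedralGroup m))) =
      cont m 0 1 ∪ ⋃ i ∈ Finset.Icc 1 t', cont m ((2 : ZMod m) ^ i) ((2 : ZMod m) ^ (i - 1)) ∧
    (∀ i ∈ Finset.Icc 1 t',
      Disjoint (cont m 0 1) (cont m ((2 : ZMod m) ^ i) ((2 : ZMod m) ^ (i - 1)))) ∧
    (∀ i ∈ Finset.Icc 1 t', ∀ j ∈ Finset.Icc 1 t', i ≠ j →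
      Disjoint (cont m ((2 : ZMod m) ^ i) ((2 : ZMod m) ^ (i - 1)))
        (cont m ((2 : ZMod m) ^ j) ((2 : ZMod m) ^ (j - 1)))) := by
  have hp := orderOf_two_pos hn
  have ht : (n = 1 ∧ 0 < ℓ ∧ t' = ℓ - 1) ∨
      (n ≠ 1 ∧ t' = max ℓ 1 + orderOf (2 : ZMod n) - 1) := by
    rcases ht' with ⟨rfl, h, rfl⟩ | ⟨h0, h, rfl⟩ | ⟨h0, h, rfl⟩
    · right
      obtain rfl : m = n := by simpa using hm
      omega
    · right
      rw [hm, per_two hn h0]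
      omega
    · exact Or.inl ⟨h, h0, rfl⟩
  clear ht' hm3
  subst hm
  have hne : ∀ i ∈ Finset.Icc 1 t', (2 : ZMod (2 ^ ℓ * n)) ^ i ≠ 0 := by
    intro i hi h
    rw [Finset.mem_Icc] at hi
    have := (two_pow_eq_zero_iff hn i).1 h
    omega
  have hlt : ∀ i ∈ Finset.Icc 1 t', ∀ j ∈ Finset.Icc 1 t', i < j →
      (2 : ZMod (2 ^ ℓ * n)) ^ i ≠ 2 ^ j := by
    intro i hi j hj hij h
    rw [Finset.mem_Icc] at hi hj
    obtain ⟨k, rfl⟩ := Nat.exists_eq_add_of_lt hij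
    obtain ⟨h1, h2⟩ := (two_pow_eq_two_pow_add_iff hn i (Nat.succ_pos k)).1 h
    have := Nat.le_of_dvd (Nat.succ_pos k) h2
    omega
  have hcover : ∀ i, 1 ≤ i → (2 : ZMod (2 ^ ℓ * n)) ^ i = 0 ∨
      ∃ j ∈ Finset.Icc 1 t', (2 : ZMod (2 ^ ℓ * n)) ^ i = 2 ^ j := by
    intro i
    induction i using Nat.strong_induction_on with
    | _ i ih =>
      intro hi
      by_cases hit : i ≤ t'
      · exact Or.inr ⟨i, Finset.mem_Icc.2 ⟨hi, hit⟩, rfl⟩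
      · rcases ht with ⟨h1, -, h2⟩ | ⟨h1, h2⟩
        · exact Or.inl ((two_pow_eq_zero_iff hn i).2 ⟨by omega, h1⟩)
        · have h3 := (two_pow_eq_two_pow_add_iff (ℓ := ℓ) hn (i - orderOf (2 : ZMod n)) hp).2
            ⟨by omega, dvd_rfl⟩
          rw [Nat.sub_add_cancel (by omega)] at h3
          rw [← h3]
          exact ih _ (by omega) (by omega)
  refine ⟨?_, fun i hi => disjoint_cont _ _ (hne i hi).symm, fun i hi j hj hij => ?_⟩
  · rw [coe_Lsg]
    ext f
    simp only [Set.mem_union, Set.mem_iUnion, exists_prop, Set.mem_ofPred_eq]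
    constructor
    · rintro (h | ⟨i, hi, hf⟩)
      · exact Or.inl h
      · rcases hcover i hi with h | ⟨j, hj, h⟩
        · rw [cont_congr h (B' := 0) (by rw [two_mul_two_pow_pred hi, h, mul_zero])] at hf
          obtain ⟨x, rfl⟩ := hf
          exact Or.inl ⟨0, by simp⟩
        · refine Or.inr ⟨j, hj, ?_⟩
          rwa [← cont_congr h]
          rw [two_mul_two_pow_pred hi, two_mul_two_pow_pred (Finset.mem_Icc.1 hj).1, h]
    · rintro (h | ⟨i, hi, hf⟩)
      · exact Or.inl h
      · exact Or.inr ⟨i, (Finset.mem_Icc.1 hi).1, hf⟩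
  · rcases hij.lt_or_gt with h | h
    · exact disjoint_cont _ _ (hlt i hi j hj h)
    · exact disjoint_cont _ _ (hlt j hj i hi h).symm
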